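/- arXiv:2409.00915 — 3 statements merged into one kernel-verified Lean document; each statement's English description precedes it below -/
import Mathlib

section
/- Let s > 0, R > 0, σ > 0 be real constants, n a positive integer, and (λ_j)_{j≥1} a nonincreasing sequence of positive reals with λ_j → 0. Define N := max{ j ≥ 1 : (σ²/n) · Σ_{m=1}^{j} λ_m^{-s/2}(λ_j^{-s/2} − λ_m^{-s/2}) < R } and κ* := σ² Σ_{j=1}^{N} λ_j^{-s/2} / ( nR + σ² Σ_{j=1}^{N} λ_j^{-s} ). Then κ* is a positive solution of the Pinsker equation (σ²/(nκ)) · Σ_{j=1}^{∞} λ_j^{-s/2} (1 − κ λ_j^{-s/2})_+ = R, and it is the unique solution among positive reals κ. -/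
open Filter

/-- The set `S = { j ≥ 1 : (σ²/n) · Σ_{m=1}^{j} λ_m^{-s/2}(λ_j^{-s/2} − λ_m^{-s/2}) < R }`. -/
noncomputable def pinskerSet (s R σ : ℝ) (n : ℕ) (lam : ℕ → ℝ) : Set ℕ :=
  {j : ℕ | 1 ≤ j ∧
    σ ^ 2 / n * ∑ m ∈ Finset.Icc 1 j,
      lam m ^ (-(s / 2)) * (lam j ^ (-(s / 2)) - lam m ^ (-(s / 2))) < R}

/-- `N := max S`. -/
noncomputable def pinskerN (s R σ : ℝ) (n : ℕ) (lam : ℕ → ℝ) : ℕ :=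
  sSup (pinskerSet s R σ n lam)

/-- The left-hand side `(σ²/(nκ)) · Σ_{j=1}^{∞} λ_j^{-s/2}(1 − κλ_j^{-s/2})_+` of the
Pinsker equation (the sum over `j ≥ 1` is written as a sum over `j + 1`, `j : ℕ`). -/
noncomputable def pinskerLHS (s σ : ℝ) (n : ℕ) (lam : ℕ → ℝ) (κ : ℝ) : ℝ :=
  σ ^ 2 / (n * κ) *
    ∑' j : ℕ, lam (j + 1) ^ (-(s / 2)) * max (1 - κ * lam (j + 1) ^ (-(s / 2))) 0

theorem sum_range_succ_eq_sum_Icc (f : ℕ → ℝ) (N : ℕ) :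
    ∑ j ∈ Finset.range N, f (j + 1) = ∑ j ∈ Finset.Icc 1 N, f j := by
  induction N with
  | zero => simp
  | succ k ih => rw [Finset.sum_range_succ, Finset.sum_Icc_succ_top (by lia), ih]

theorem summable_mul_max_one_sub {a : ℕ → ℝ} (ha : Tendsto a atTop atTop) {κ : ℝ} (hκ : 0 < κ) :
    Summable fun j ↦ a j * max (1 - κ * a j) 0 := by
  obtain ⟨J, hJ⟩ := eventually_atTop.1 (ha.eventually_ge_atTop (1 / κ))
  refine summable_of_ne_finset_zero (s := Finset.range J) fun j hj ↦ ?_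
  have h : 1 / κ ≤ a j := hJ j (by simpa using hj)
  rw [div_le_iff₀' hκ] at h
  rw [max_eq_right (by linarith), mul_zero]

theorem tsum_mul_max_one_sub_eq {a : ℕ → ℝ} (hmono : ∀ i j, 1 ≤ i → i ≤ j → a i ≤ a j) {N : ℕ}
    {κ : ℝ} (hκ : 0 < κ) (hle : κ * a N ≤ 1) (hge : 1 ≤ κ * a (N + 1)) :
    ∑' j, a (j + 1) * max (1 - κ * a (j + 1)) 0 =
      ∑ j ∈ Finset.Icc 1 N, a j - κ * ∑ j ∈ Finset.Icc 1 N, a j ^ 2 := by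
  rw [tsum_eq_sum (s := Finset.range N),
    sum_range_succ_eq_sum_Icc (fun j ↦ a j * max (1 - κ * a j) 0),
    Finset.mul_sum, ← Finset.sum_sub_distrib]
  · refine Finset.sum_congr rfl fun j hj ↦ ?_
    rw [Finset.mem_Icc] at hj
    have := mul_le_mul_of_nonneg_left (hmono j N hj.1 hj.2) hκ.le
    rw [max_eq_left (by linarith)]
    ring
  · intro j hj
    have h : N ≤ j := by simpa using hj
    have := mul_le_mul_of_nonneg_left (hmono (N + 1) (j + 1) (by lia) (by lia)) hκ.le
    rw [max_eq_right (by linarith), mul_zero]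

/-- Termwise, `a (1 - κ a)₊` is antitone in `κ`, whereas `κ c` is strictly increasing. -/
theorem le_of_tsum_mul_max_one_sub_eq {a : ℕ → ℝ} (hpos : ∀ j, 0 < a j)
    (ha : Tendsto a atTop atTop) {c κ κ' : ℝ} (hc : 0 < c) (hκ : 0 < κ) (hκ' : 0 < κ')
    (h : ∑' j, a j * max (1 - κ * a j) 0 = κ * c)
    (h' : ∑' j, a j * max (1 - κ' * a j) 0 = κ' * c) : κ' ≤ κ := by
  by_contra! hlt
  have key : κ' * c ≤ κ * c := by
    rw [← h, ← h']
    refine (summable_mul_max_one_sub ha hκ').tsum_le_tsum (fun j ↦ ?_)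
      (summable_mul_max_one_sub ha hκ)
    have := hpos j
    gcongr
  exact absurd (le_of_mul_le_mul_right key hc) hlt.not_ge

theorem sum_mul_sub_eq (a : ℕ → ℝ) (x : ℝ) (t : Finset ℕ) :
    ∑ m ∈ t, a m * (x - a m) = x * ∑ m ∈ t, a m - ∑ m ∈ t, a m ^ 2 := by
  rw [Finset.mul_sum, ← Finset.sum_sub_distrib]
  exact Finset.sum_congr rfl fun m _ ↦ by ring

theorem tendsto_rpow_neg_half {s : ℝ} (hs : 0 < s) {lam : ℕ → ℝ} (hpos : ∀ j, 1 ≤ j → 0 < lam j)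
    (hlim : Tendsto lam atTop (nhds 0)) :
    Tendsto (fun j ↦ lam j ^ (-(s / 2))) atTop atTop := by
  refine (tendsto_rpow_neg_nhdsGT_zero (by linarith)).comp
    (tendsto_nhdsWithin_iff.2 ⟨hlim, ?_⟩)
  filter_upwards [eventually_ge_atTop 1] with j hj using hpos j hj

theorem pinskerLHS_eq_iff {s R σ : ℝ} (hσ : 0 < σ) {n : ℕ} (hn : 0 < n) (lam : ℕ → ℝ)
    {κ : ℝ} (hκ : 0 < κ) :
    pinskerLHS s σ n lam κ = R ↔
      ∑' j : ℕ, lam (j + 1) ^ (-(s / 2)) * max (1 - κ * lam (j + 1) ^ (-(s / 2))) 0 =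
        κ * (n * R / σ ^ 2) := by
  have hn' : (0 : ℝ) < n := by exact_mod_cast hn
  unfold pinskerLHS
  generalize ∑' j : ℕ, lam (j + 1) ^ (-(s / 2)) * max (1 - κ * lam (j + 1) ^ (-(s / 2))) 0 = T
  rw [div_mul_eq_mul_div, div_eq_iff (by positivity), mul_div_assoc', eq_div_iff (by positivity)]
  constructor <;> intro h <;> linarith

theorem mem_pinskerSet_iff {s R σ : ℝ} (hσ : 0 < σ) {n : ℕ} (hn : 0 < n) (lam : ℕ → ℝ) (j : ℕ) :
    j ∈ pinskerSet s R σ n lam ↔ 1 ≤ j ∧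
      ∑ m ∈ Finset.Icc 1 j, lam m ^ (-(s / 2)) * (lam j ^ (-(s / 2)) - lam m ^ (-(s / 2))) <
        n * R / σ ^ 2 := by
  have hn' : (0 : ℝ) < n := by exact_mod_cast hn
  unfold pinskerSet
  rw [Set.mem_ofPred_eq, div_mul_eq_mul_div, div_lt_iff₀ hn', lt_div_iff₀ (by positivity),
    mul_comm (σ ^ 2), mul_comm R]

theorem bddAbove_setOf_sum_mul_sub_lt {a : ℕ → ℝ} (hpos : ∀ j, 1 ≤ j → 0 < a j)
    (hmono : ∀ i j, 1 ≤ i → i ≤ j → a i ≤ a j) (ha : Tendsto a atTop atTop) (c : ℝ) :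
    BddAbove {j : ℕ | 1 ≤ j ∧ ∑ m ∈ Finset.Icc 1 j, a m * (a j - a m) < c} := by
  have h1 := hpos 1 le_rfl
  obtain ⟨J, hJ⟩ := eventually_atTop.1 (ha.eventually_ge_atTop (c / a 1 + a 1))
  refine ⟨J, fun j ⟨hj1, hj⟩ ↦ ?_⟩
  by_contra! hlt
  have hsum : a 1 * (a j - a 1) ≤ ∑ m ∈ Finset.Icc 1 j, a m * (a j - a m) := by
    refine Finset.single_le_sum (f := fun m ↦ a m * (a j - a m)) (fun m hm ↦ ?_)
      (Finset.mem_Icc.2 ⟨le_rfl, hj1⟩)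
    rw [Finset.mem_Icc] at hm
    exact mul_nonneg (hpos m hm.1).le (sub_nonneg.2 (hmono m j hm.1 hm.2))
  have hc : c / a 1 ≤ a j - a 1 := by linarith [hJ j hlt.le]
  rw [div_le_iff₀' h1] at hc
  linarith

/-- `κ* := σ² Σ_{j=1}^{N} λ_j^{-s/2} / ( nR + σ² Σ_{j=1}^{N} λ_j^{-s} )` is the unique
positive solution of the Pinsker equation. -/
theorem statement1 (s R σ : ℝ) (hs : 0 < s) (hR : 0 < R) (hσ : 0 < σ)
    (n : ℕ) (hn : 0 < n) (lam : ℕ → ℝ)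
    (hpos : ∀ j, 1 ≤ j → 0 < lam j)
    (hanti : ∀ i j, 1 ≤ i → i ≤ j → lam j ≤ lam i)
    (hlim : Tendsto lam atTop (nhds 0))
    (κstar : ℝ)
    (hκdef : κstar = σ ^ 2 * (∑ j ∈ Finset.Icc 1 (pinskerN s R σ n lam), lam j ^ (-(s / 2))) /
      (n * R + σ ^ 2 * ∑ j ∈ Finset.Icc 1 (pinskerN s R σ n lam), lam j ^ (-s))) :
    0 < κstar ∧ pinskerLHS s σ n lam κstar = R ∧
      ∀ κ : ℝ, 0 < κ → pinskerLHS s σ n lam κ = R → κ = κstar := by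
  have hn' : (0 : ℝ) < n := by exact_mod_cast hn
  have hc : 0 < n * R / σ ^ 2 := by positivity
  have hmem := mem_pinskerSet_iff (s := s) (R := R) hσ hn lam
  have hlim' := tendsto_rpow_neg_half hs hpos hlim
  have hsq : ∀ j, 1 ≤ j → lam j ^ (-s) = (lam j ^ (-(s / 2))) ^ 2 := fun j hj ↦ by
    rw [← Real.rpow_mul_natCast (hpos j hj).le]
    congr 1
    push_cast
    ring
  have hsq' : ∑ j ∈ Finset.Icc 1 (pinskerN s R σ n lam), lam j ^ (-s) =
      ∑ j ∈ Finset.Icc 1 (pinskerN s R σ n lam), (lam j ^ (-(s / 2))) ^ 2 :=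
    Finset.sum_congr rfl fun j hj ↦ hsq j (Finset.mem_Icc.1 hj).1
  have hiff : ∀ κ : ℝ, 0 < κ → _ := fun κ hκ ↦ pinskerLHS_eq_iff (s := s) (R := R) hσ hn lam hκ
  have hmono : ∀ i j, 1 ≤ i → i ≤ j → lam i ^ (-(s / 2)) ≤ lam j ^ (-(s / 2)) :=
    fun i j hi hij ↦ Real.rpow_le_rpow_of_nonpos (hpos j (hi.trans hij)) (hanti i j hi hij)
      (by linarith)
  have hapos : ∀ j, 1 ≤ j → 0 < lam j ^ (-(s / 2)) := fun j hj ↦ Real.rpow_pos_of_pos (hpos j hj) _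
  rw [hsq'] at hκdef
  have hbdd : BddAbove (pinskerSet s R σ n lam) := by
    rw [Set.ext hmem]
    exact bddAbove_setOf_sum_mul_sub_lt hapos hmono hlim' _
  have hN : pinskerN s R σ n lam ∈ pinskerSet s R σ n lam :=
    Nat.sSup_mem ⟨1, (hmem 1).2 ⟨le_rfl, by simpa using hc⟩⟩ hbdd
  have hN1 : pinskerN s R σ n lam + 1 ∉ pinskerSet s R σ n lam := fun h ↦
    (le_csSup hbdd h).not_gt (Nat.lt_succ_self _)
  generalize pinskerN s R σ n lam = N at hκdef hN hN1
  rw [hmem] at hN hN1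
  obtain ⟨hN0, hN⟩ := hN
  replace hN1 := not_lt.1 fun h ↦ hN1 ⟨by lia, h⟩
  rw [Finset.sum_Icc_succ_top (by lia), sub_self, mul_zero, add_zero] at hN1
  rw [sum_mul_sub_eq (fun j ↦ lam j ^ (-(s / 2)))] at hN hN1
  have hA : 0 < ∑ j ∈ Finset.Icc 1 N, lam j ^ (-(s / 2)) :=
    Finset.sum_pos (fun j hj ↦ hapos j (Finset.mem_Icc.1 hj).1) ⟨1, Finset.mem_Icc.2 ⟨le_rfl, hN0⟩⟩
  have hB : 0 ≤ ∑ j ∈ Finset.Icc 1 N, (lam j ^ (-(s / 2))) ^ 2 :=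
    Finset.sum_nonneg fun j _ ↦ sq_nonneg _
  have htsum := fun κ hκ ↦
    tsum_mul_max_one_sub_eq (a := fun j ↦ lam j ^ (-(s / 2))) hmono (N := N) (κ := κ) hκ
  have hκ : κstar = (∑ j ∈ Finset.Icc 1 N, lam j ^ (-(s / 2))) /
      (n * R / σ ^ 2 + ∑ j ∈ Finset.Icc 1 N, (lam j ^ (-(s / 2))) ^ 2) := by
    rw [hκdef]
    field_simp
  generalize ∑ j ∈ Finset.Icc 1 N, lam j ^ (-(s / 2)) = A at *
  generalize ∑ j ∈ Finset.Icc 1 N, (lam j ^ (-(s / 2))) ^ 2 = B at *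
  have hκpos : 0 < κstar := by rw [hκ]; positivity
  have hD : 0 < n * R / σ ^ 2 + B := by positivity
  have hsol : ∑' j : ℕ, lam (j + 1) ^ (-(s / 2)) * max (1 - κstar * lam (j + 1) ^ (-(s / 2))) 0 =
      κstar * (n * R / σ ^ 2) := by
    rw [htsum κstar hκpos]
    · linarith [(eq_div_iff hD.ne').1 hκ]
    · rw [hκ, div_mul_eq_mul_div, div_le_one hD]
      linarith
    · rw [hκ, div_mul_eq_mul_div, one_le_div hD]
      linarith
  have hshift := hlim'.comp (tendsto_add_atTop_nat 1)
  have hspos : ∀ j : ℕ, 0 < lam (j + 1) ^ (-(s / 2)) := fun j ↦ hapos _ (by lia)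
  refine ⟨hκpos, (hiff _ hκpos).2 hsol, fun κ hκ0 h ↦ ?_⟩
  rw [hiff κ hκ0] at h
  exact le_antisymm (le_of_tsum_mul_max_one_sub_eq hspos hshift hc hκpos hκ0 hsol h)
    (le_of_tsum_mul_max_one_sub_eq hspos hshift hc hκ0 hκpos h hsol)
end

section
/- Let s > 0, R > 0, σ > 0 be real constants, n a positive integer, and (λ_j)_{j≥1} a nonincreasing sequence of positive reals with λ_j → 0. Let κ* be the unique positive solution of the Pinsker equation (σ²/(nκ)) · Σ_{j=1}^{∞} λ_j^{-s/2}(1 − κ λ_j^{-s/2})_+ = R, and let N := max{ j ≥ 1 : (σ²/n) · Σ_{m=1}^{j} λ_m^{-s/2}(λ_j^{-s/2} − λ_m^{-s/2}) < R }. Then the set { j ≥ 1 : λ_j^{s/2} > κ* } is nonempty and finite, and N = max{ j ≥ 1 : λ_j^{s/2} > κ* }. -/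
open Filter

/-- The partial sum `Σ_{m=1}^{j} a_m (a_j - a_m)`, scaled by `κ`, lies strictly below
`Σ_{m≥1} a_m (1 - κ a_m)_+` exactly when `κ a_j < 1`. -/
theorem mul_sum_mul_sub_lt_tsum_iff {a : ℕ → ℝ} {κ : ℝ} (hκ : 0 < κ)
    (ha : ∀ j, 1 ≤ j → 0 < a j) (hmono : ∀ i j, 1 ≤ i → i ≤ j → a i ≤ a j)
    (hsum : Summable fun j : ℕ => a (j + 1) * max (1 - κ * a (j + 1)) 0)
    {j : ℕ} (hj : 1 ≤ j) :
    κ * ∑ m ∈ Finset.Icc 1 j, a m * (a j - a m) <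
      ∑' i : ℕ, a (i + 1) * max (1 - κ * a (i + 1)) 0 ↔ κ * a j < 1 := by
  have hre : ∑ m ∈ Finset.Icc 1 j, a m * (a j - a m) =
      ∑ i ∈ Finset.range j, a (i + 1) * (a j - a (i + 1)) := by
    rw [Finset.range_eq_Ico, Finset.sum_Ico_add' (fun m => a m * (a j - a m)) 0 j 1]
    rfl
  rw [hre, Finset.mul_sum]
  constructor
  · contrapose!
    intro h
    rw [tsum_eq_sum (s := Finset.range j)]
    · refine Finset.sum_le_sum fun i hi => ?_
      have hij : a (i + 1) ≤ a j := hmono _ _ (by omega) (Finset.mem_range.mp hi)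
      have hκij : κ * a (i + 1) ≤ κ * a j := mul_le_mul_of_nonneg_left hij hκ.le
      have hmax : max (1 - κ * a (i + 1)) 0 ≤ κ * a j - κ * a (i + 1) :=
        max_le (by linarith) (by linarith)
      calc a (i + 1) * max (1 - κ * a (i + 1)) 0
          ≤ a (i + 1) * (κ * a j - κ * a (i + 1)) :=
            mul_le_mul_of_nonneg_left hmax (ha _ (by omega)).le
        _ = κ * (a (i + 1) * (a j - a (i + 1))) := by ring
    · intro i hi
      have hij : a j ≤ a (i + 1) := hmono _ _ hj (by rw [Finset.mem_range] at hi; omega)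
      have hκij : κ * a j ≤ κ * a (i + 1) := mul_le_mul_of_nonneg_left hij hκ.le
      rw [max_eq_right (by linarith), mul_zero]
  · intro h
    refine lt_of_lt_of_le (Finset.sum_lt_sum_of_nonempty
      (g := fun i => a (i + 1) * max (1 - κ * a (i + 1)) 0) ⟨0, Finset.mem_range.mpr hj⟩
      fun i _ => ?_)
      (hsum.sum_le_tsum _ fun i _ => mul_nonneg (ha _ (by omega)).le (le_max_right _ _))
    have hmax : κ * a j - κ * a (i + 1) < max (1 - κ * a (i + 1)) 0 :=
      lt_max_of_lt_left (by linarith)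
    calc κ * (a (i + 1) * (a j - a (i + 1)))
        = a (i + 1) * (κ * a j - κ * a (i + 1)) := by ring
      _ < a (i + 1) * max (1 - κ * a (i + 1)) 0 :=
        mul_lt_mul_of_pos_left hmax (ha _ (by omega))

/-- If `κ*` is the (unique) positive solution of the Pinsker equation, then the set
`{ j ≥ 1 : λ_j^{s/2} > κ* }` is nonempty and finite, and `N` is its maximum. -/
theorem statement2 (s R σ : ℝ) (hs : 0 < s) (hR : 0 < R) (hσ : 0 < σ)
    (n : ℕ) (hn : 0 < n) (lam : ℕ → ℝ)
    (hpos : ∀ j, 1 ≤ j → 0 < lam j)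
    (hanti : ∀ i j, 1 ≤ i → i ≤ j → lam j ≤ lam i)
    (hlim : Tendsto lam atTop (nhds 0))
    (κstar : ℝ) (hκpos : 0 < κstar)
    (hκeq : pinskerLHS s σ n lam κstar = R) :
    {j : ℕ | 1 ≤ j ∧ κstar < lam j ^ (s / 2)}.Nonempty ∧
    {j : ℕ | 1 ≤ j ∧ κstar < lam j ^ (s / 2)}.Finite ∧
    pinskerN s R σ n lam = sSup {j : ℕ | 1 ≤ j ∧ κstar < lam j ^ (s / 2)} := by
  have hs2 : 0 < s / 2 := by positivity
  have hn' : (0 : ℝ) < n := by exact_mod_cast hn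
  have ha : ∀ j, 1 ≤ j → 0 < lam j ^ (-(s / 2)) := fun j hj => Real.rpow_pos_of_pos (hpos j hj) _
  have hmono : ∀ i j, 1 ≤ i → i ≤ j → lam i ^ (-(s / 2)) ≤ lam j ^ (-(s / 2)) :=
    fun i j hi hij => Real.rpow_le_rpow_of_nonpos (hpos j (hi.trans hij)) (hanti i j hi hij)
      (by linarith)
  have hiff : ∀ j, 1 ≤ j → (κstar < lam j ^ (s / 2) ↔ κstar * lam j ^ (-(s / 2)) < 1) := by
    intro j hj
    rw [Real.rpow_neg (hpos j hj).le, ← div_eq_mul_inv,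
      div_lt_one (Real.rpow_pos_of_pos (hpos j hj) _)]
  have hfin : {j : ℕ | 1 ≤ j ∧ κstar < lam j ^ (s / 2)}.Finite := by
    have hlim' : Tendsto (fun j => lam j ^ (s / 2)) atTop (nhds 0) := by
      simpa [Real.zero_rpow hs2.ne'] using hlim.rpow_const (Or.inr hs2.le)
    obtain ⟨M, hM⟩ := eventually_atTop.mp (hlim'.eventually_lt_const hκpos)
    refine (Set.finite_Iio M).subset fun j hj => ?_
    by_contra hlt
    exact lt_asymm hj.2 (hM j (not_lt.mp hlt))
  have hzero : ∀ i : ℕ, i + 1 ∉ {j : ℕ | 1 ≤ j ∧ κstar < lam j ^ (s / 2)} →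
      lam (i + 1) ^ (-(s / 2)) * max (1 - κstar * lam (i + 1) ^ (-(s / 2))) 0 = 0 := by
    intro i hi
    have h : ¬ κstar * lam (i + 1) ^ (-(s / 2)) < 1 := fun h =>
      hi ⟨by omega, (hiff _ (by omega)).mpr h⟩
    rw [max_eq_right (by linarith), mul_zero]
  have hsum : Summable fun i : ℕ =>
      lam (i + 1) ^ (-(s / 2)) * max (1 - κstar * lam (i + 1) ^ (-(s / 2))) 0 := by
    refine summable_of_hasFiniteSupport
      ((hfin.preimage (add_left_injective 1).injOn).subset fun i hi => ?_)
    by_contra h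
    exact hi (hzero i h)
  refine ⟨?_, hfin, ?_⟩
  · by_contra hempty
    rw [Set.not_nonempty_iff_eq_empty] at hempty
    have h0 : pinskerLHS s σ n lam κstar = 0 := by
      rw [pinskerLHS, tsum_congr fun i => hzero i (by simp [hempty]), tsum_zero, mul_zero]
    linarith
  · rw [pinskerN]
    congr 1
    ext j
    refine and_congr_right fun hj => ?_
    rw [hiff j hj, ← mul_sum_mul_sub_lt_tsum_iff (a := fun j => lam j ^ (-(s / 2)))
      hκpos ha hmono hsum hj, ← hκeq, pinskerLHS]
    have hc : σ ^ 2 / n = σ ^ 2 / (n * κstar) * κstar := by field_simp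
    rw [hc, mul_assoc]
    exact mul_lt_mul_iff_right₀ (by positivity)
end

section
/- Let s > 0, R > 0, σ > 0 be real constants, n a positive integer, and (λ_j)_{j≥1} a nonincreasing sequence of positive reals with λ_j → 0. Let κ* be the unique positive solution of the Pinsker equation, set ℓ_j := (1 − κ* λ_j^{-s/2})_+ for j ≥ 1 and D* := (σ²/n) Σ_{j=1}^{∞} ℓ_j (a finite sum since ℓ_j = 0 for all but finitely many j). Then the supremum, over all real sequences θ = (θ_j)_{j≥1} satisfying Σ_{j=1}^{∞} λ_j^{-s} θ_j² ≤ R, of the quantity Σ_{j=1}^{∞} (1 − ℓ_j)² θ_j² + (σ²/n) Σ_{j=1}^{∞} ℓ_j², equals D*. -/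
open Filter

/-- The Pinsker weights `ℓ_j := (1 − κ* λ_j^{-s/2})_+`. -/
noncomputable def pinskerEll (s : ℝ) (lam : ℕ → ℝ) (κstar : ℝ) (j : ℕ) : ℝ :=
  max (1 - κstar * lam j ^ (-(s / 2))) 0

/-- `D* := (σ²/n) Σ_{j=1}^{∞} ℓ_j`. -/
noncomputable def pinskerD (s σ : ℝ) (n : ℕ) (lam : ℕ → ℝ) (κstar : ℝ) : ℝ :=
  σ ^ 2 / n * ∑' j : ℕ, pinskerEll s lam κstar (j + 1)

section PinskerWeights

variable {a l : ℕ → ℝ} {κ c R : ℝ}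

/-- A function of `max (1 - κ a_j) 0` vanishing at zero is summable when `a_j → ∞`. -/
theorem summable_of_pinsker_weight (ha : Tendsto a atTop atTop) (hκ : 0 < κ)
    (hl : ∀ j, l j = max (1 - κ * a j) 0) {f : ℕ → ℝ} (hf : ∀ j, l j = 0 → f j = 0) :
    Summable f := by
  have h : ∀ᶠ j in cofinite, f j = 0 := by
    rw [Nat.cofinite_eq_atTop]
    filter_upwards [(ha.const_mul_atTop hκ).eventually_ge_atTop 1] with j hj
    exact hf j (by rw [hl, max_eq_right (by linarith)])
  exact summable_of_hasFiniteSupport h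

theorem pinsker_weight_mul (hl : ∀ j, l j = max (1 - κ * a j) 0) (j : ℕ) :
    κ * (a j * l j) = l j - l j ^ 2 := by
  rcases max_choice (1 - κ * a j) 0 with h | h <;> rw [hl, h] <;> ring

/-- If `(c / κ) Σ a_j l_j = R` then the extremal risk `κ² R + c Σ l_j²` equals `c Σ l_j`. -/
theorem pinsker_risk_eq (ha : Tendsto a atTop atTop) (hκ : 0 < κ)
    (hl : ∀ j, l j = max (1 - κ * a j) 0) (hR : c / κ * ∑' j, a j * l j = R) :
    κ ^ 2 * R + c * ∑' j, l j ^ 2 = c * ∑' j, l j := by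
  have h : κ * ∑' j, a j * l j = ∑' j, l j - ∑' j, l j ^ 2 := by
    rw [← tsum_mul_left, ← Summable.tsum_sub
      (summable_of_pinsker_weight ha hκ hl fun _ h => h)
      (summable_of_pinsker_weight ha hκ hl fun _ h => by simp [h])]
    exact tsum_congr (pinsker_weight_mul hl)
  have h' : κ ^ 2 * R = c * (κ * ∑' j, a j * l j) := by
    rw [← hR]; field_simp
  rw [h', h]; ring

theorem tsum_pinsker_bias_le (ha0 : ∀ j, 0 < a j) (hκ : 0 < κ)
    (hl : ∀ j, l j = max (1 - κ * a j) 0) {θ : ℕ → ℝ}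
    (hθ : Summable fun j => a j ^ 2 * θ j ^ 2) (hθR : ∑' j, a j ^ 2 * θ j ^ 2 ≤ R) :
    ∑' j, (1 - l j) ^ 2 * θ j ^ 2 ≤ κ ^ 2 * R := by
  have hle : ∀ j, (1 - l j) ^ 2 * θ j ^ 2 ≤ κ ^ 2 * (a j ^ 2 * θ j ^ 2) := fun j => by
    have hκa : 0 < κ * a j := mul_pos hκ (ha0 j)
    have h₁ : 1 - l j ≤ κ * a j := by
      rw [hl]; linarith [le_max_left (1 - κ * a j) 0]
    have h₀ : 0 ≤ 1 - l j := by
      rw [hl, sub_nonneg]; exact max_le (by linarith) zero_le_one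
    calc (1 - l j) ^ 2 * θ j ^ 2 ≤ (κ * a j) ^ 2 * θ j ^ 2 := by gcongr
      _ = κ ^ 2 * (a j ^ 2 * θ j ^ 2) := by ring
  calc ∑' j, (1 - l j) ^ 2 * θ j ^ 2 ≤ ∑' j, κ ^ 2 * (a j ^ 2 * θ j ^ 2) :=
        Summable.tsum_le_tsum hle
          (Summable.of_nonneg_of_le (fun j => by positivity) hle (hθ.mul_left _))
          (hθ.mul_left _)
    _ = κ ^ 2 * ∑' j, a j ^ 2 * θ j ^ 2 := tsum_mul_left
    _ ≤ κ ^ 2 * R := by gcongr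

/-- The least favourable sequence `θ_j² = c l_j / (κ a_j)` exhausts the ellipsoid budget. -/
theorem exists_pinsker_bias_eq (ha0 : ∀ j, 0 < a j) (ha : Tendsto a atTop atTop) (hκ : 0 < κ)
    (hc : 0 ≤ c) (hl : ∀ j, l j = max (1 - κ * a j) 0) (hR : c / κ * ∑' j, a j * l j = R) :
    ∃ θ : ℕ → ℝ, (Summable fun j => a j ^ 2 * θ j ^ 2) ∧ ∑' j, a j ^ 2 * θ j ^ 2 = R ∧
      ∑' j, (1 - l j) ^ 2 * θ j ^ 2 = κ ^ 2 * R := by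
  have hl0 : ∀ j, 0 ≤ l j := fun j => by rw [hl]; exact le_max_right _ _
  have hsq : ∀ j, √(c * l j / (κ * a j)) ^ 2 = c * l j / (κ * a j) := fun j =>
    Real.sq_sqrt (div_nonneg (mul_nonneg hc (hl0 j)) (mul_pos hκ (ha0 j)).le)
  have hbudget : ∀ j, a j ^ 2 * √(c * l j / (κ * a j)) ^ 2 = c / κ * (a j * l j) := fun j => by
    have := (ha0 j).ne'
    rw [hsq]; field_simp
  have hbias : ∀ j, (1 - l j) ^ 2 * √(c * l j / (κ * a j)) ^ 2
      = κ ^ 2 * (a j ^ 2 * √(c * l j / (κ * a j)) ^ 2) := fun j => by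
    rcases max_choice (1 - κ * a j) 0 with h | h
    · rw [← hl] at h
      rw [show 1 - l j = κ * a j by rw [h]; ring]
      ring
    · rw [← hl] at h
      simp [h]
  have hsum : ∑' j, a j ^ 2 * √(c * l j / (κ * a j)) ^ 2 = R := by
    rw [tsum_congr hbudget, tsum_mul_left, hR]
  refine ⟨fun j => √(c * l j / (κ * a j)),
    summable_of_pinsker_weight ha hκ hl fun j h => by simp [h], hsum, ?_⟩
  rw [tsum_congr hbias, tsum_mul_left, hsum]

end PinskerWeights

/-- The supremum over the ellipsoid `Σ_j λ_j^{-s} θ_j² ≤ R` of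
`Σ_j (1 − ℓ_j)² θ_j² + (σ²/n) Σ_j ℓ_j²` equals `D*`. -/
theorem statement3 (s R σ : ℝ) (hs : 0 < s) (hR : 0 < R) (hσ : 0 < σ)
    (n : ℕ) (hn : 0 < n) (lam : ℕ → ℝ)
    (hpos : ∀ j, 1 ≤ j → 0 < lam j)
    (hanti : ∀ i j, 1 ≤ i → i ≤ j → lam j ≤ lam i)
    (hlim : Tendsto lam atTop (nhds 0))
    (κstar : ℝ) (hκpos : 0 < κstar)
    (hκeq : pinskerLHS s σ n lam κstar = R) :
    sSup {x : ℝ | ∃ θ : ℕ → ℝ,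
        Summable (fun j : ℕ => lam (j + 1) ^ (-s) * θ (j + 1) ^ 2) ∧
        (∑' j : ℕ, lam (j + 1) ^ (-s) * θ (j + 1) ^ 2) ≤ R ∧
        x = (∑' j : ℕ, (1 - pinskerEll s lam κstar (j + 1)) ^ 2 * θ (j + 1) ^ 2) +
            σ ^ 2 / n * ∑' j : ℕ, pinskerEll s lam κstar (j + 1) ^ 2} =
      pinskerD s σ n lam κstar := by
  have hlam : ∀ j, 0 < lam (j + 1) := fun j => hpos _ (Nat.le_add_left 1 j)
  set a : ℕ → ℝ := fun j => lam (j + 1) ^ (-(s / 2)) with ha_def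
  have ha0 : ∀ j, 0 < a j := fun j => Real.rpow_pos_of_pos (hlam j) _
  have ha : Tendsto a atTop atTop :=
    (tendsto_rpow_neg_nhdsGT_zero (by linarith : -(s / 2) < 0)).comp
      (tendsto_nhdsWithin_iff.2 ⟨(tendsto_add_atTop_iff_nat 1).2 hlim, .of_forall hlam⟩)
  have hsq : ∀ j, lam (j + 1) ^ (-s) = a j ^ 2 := fun j => by
    rw [ha_def, ← Real.rpow_natCast, ← Real.rpow_mul (hlam j).le]
    congr 1
    push_cast
    ring
  have hl : ∀ j, pinskerEll s lam κstar (j + 1) = max (1 - κstar * a j) 0 := fun _ => rfl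
  have hbudget : σ ^ 2 / n / κstar * ∑' j, a j * pinskerEll s lam κstar (j + 1) = R := by
    rw [div_div]; exact hκeq
  have hrisk := pinsker_risk_eq ha hκpos hl hbudget
  simp only [hsq]
  refine IsGreatest.csSup_eq ⟨?_, ?_⟩
  · obtain ⟨θ, hθ, hθR, hbias⟩ :=
      exists_pinsker_bias_eq ha0 ha hκpos (by positivity) hl hbudget
    refine ⟨fun j => θ (j - 1), hθ, hθR.le, ?_⟩
    simp only [Nat.add_sub_cancel]
    rw [hbias, hrisk, pinskerD]
  · rintro x ⟨θ, hθ, hθR, rfl⟩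
    have hbias := tsum_pinsker_bias_le ha0 hκpos hl (θ := fun j => θ (j + 1)) hθ hθR
    rw [pinskerD, ← hrisk]
    gcongr
end
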